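/- arXiv:0909.3826 — 3 statements merged into one kernel-verified Lean document; each statement's English description precedes it below -/
import Mathlib

section
/- Let X, Y : ℝ^m → ℝ^m be smooth vector fields admitting global flows φ, ψ : ℝ × ℝ^m → ℝ^m, i.e. φ(0,x) = x and ∂_t φ(t,x) = X(φ(t,x)) for all (t,x), and similarly for ψ and Y. Then for every smooth function f : ℝ^m → ℝ and every x₀ ∈ ℝ^m, f(ψ(t, φ(t, ψ(−t, φ(−t, x₀))))) = f(x₀) + t² · Df(x₀)[DY(x₀)X(x₀) − DX(x₀)Y(x₀)] + o(t²) as t → 0, where DY(x₀)X(x₀) − DX(x₀)Y(x₀) = [X,Y](x₀) is the Lie bracket of X and Y at x₀. -/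
open Asymptotics ContDiff

noncomputable section

open Filter Topology Metric

section FlowExpansion

variable {E : Type*} [NormedAddCommGroup E] [NormedSpace ℝ E]

/-- A trapping estimate: forward in time, integral curves starting near `x₀` move at bounded
speed. -/
theorem norm_flow_sub_le_of_nonneg {X : E → E} {φ : ℝ → E → E}
    (hφ0 : ∀ x, φ 0 x = x) (hφ : ∀ t x, HasDerivAt (fun s => φ s x) (X (φ t x)) t)
    {x₀ c : E} {M r s : ℝ} (hM : ∀ y ∈ ball x₀ r, ‖X y‖ < M)
    (hc : c ∈ ball x₀ (r / 2)) (hs0 : 0 ≤ s) (hs : M * s < r / 2) :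
    ‖φ s c - c‖ ≤ M * s := by
  have hM0 : 0 < M := by
    refine (norm_nonneg _).trans_lt (hM x₀ (mem_ball_self ?_))
    have := pos_of_mem_ball hc
    linarith
  refine image_norm_le_of_norm_deriv_right_lt_deriv_boundary (a := 0) (b := s)
    (f := fun u => φ u c - c) (f' := fun u => X (φ u c)) (B := fun u => M * u)
    (B' := fun _ => M) ?_ ?_ ?_ ?_ ?_ ⟨hs0, le_rfl⟩
  · exact fun u _ => ((hφ u c).sub_const c).continuousAt.continuousWithinAt
  · exact fun u _ => ((hφ u c).sub_const c).hasDerivWithinAt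
  · simp [hφ0]
  · exact fun u => by simpa using (hasDerivAt_id u).const_mul M
  · intro u hu hnorm
    refine hM _ ?_
    have hle : M * u ≤ M * s := by gcongr; exact hu.2.le
    have htri := dist_triangle (φ u c) c x₀
    rw [mem_ball] at hc ⊢
    rw [dist_eq_norm (φ u c) c] at htri
    linarith

theorem norm_flow_sub_le {X : E → E} {φ : ℝ → E → E}
    (hφ0 : ∀ x, φ 0 x = x) (hφ : ∀ t x, HasDerivAt (fun s => φ s x) (X (φ t x)) t)
    {x₀ c : E} {M r s : ℝ} (hM : ∀ y ∈ ball x₀ r, ‖X y‖ < M)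
    (hc : c ∈ ball x₀ (r / 2)) (hs : M * |s| < r / 2) :
    ‖φ s c - c‖ ≤ M * |s| := by
  rcases le_total 0 s with h | h
  · rw [abs_of_nonneg h] at hs ⊢
    exact norm_flow_sub_le_of_nonneg hφ0 hφ hM hc h hs
  · rw [abs_of_nonpos h] at hs ⊢
    have hrev : ∀ t x, HasDerivAt (fun s => φ (-s) x) (-X (φ (-t) x)) t := fun t x => by
      simpa [Function.comp_def] using (hφ (-t) x).scomp t (hasDerivAt_neg t)
    simpa using norm_flow_sub_le_of_nonneg (X := fun y => -X y) (φ := fun t => φ (-t))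
      (by simpa using hφ0) hrev (fun y hy => by simpa using hM y hy) hc (neg_nonneg.2 h) hs

theorem isBigO_flow_sub {X : E → E} {φ : ℝ → E → E}
    (hφ0 : ∀ x, φ 0 x = x) (hφ : ∀ t x, HasDerivAt (fun s => φ s x) (X (φ t x)) t)
    {x₀ : E} (hX : ContinuousAt X x₀) :
    (fun p : ℝ × E => φ p.1 p.2 - p.2) =O[𝓝 (0, x₀)] fun p => p.1 := by
  obtain ⟨r, hr, hM⟩ := Metric.eventually_nhds_iff_ball.1
    (hX.norm.eventually_lt_const (lt_add_one ‖X x₀‖))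
  refine IsBigO.of_bound (‖X x₀‖ + 1) ?_
  have hcont : ContinuousAt (fun p : ℝ × E => (‖X x₀‖ + 1) * |p.1|) (0, x₀) := by fun_prop
  have hs : ∀ᶠ p : ℝ × E in 𝓝 (0, x₀), (‖X x₀‖ + 1) * |p.1| < r / 2 :=
    hcont.eventually_lt_const (by simpa using hr)
  have hc : ∀ᶠ p : ℝ × E in 𝓝 (0, x₀), p.2 ∈ ball x₀ (r / 2) :=
    continuousAt_snd.eventually_mem (ball_mem_nhds _ (half_pos hr))
  filter_upwards [hs, hc] with p hs hc
  exact norm_flow_sub_le hφ0 hφ hM hc hs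

/-- Integrating a parametric little-o bound on the derivative in time. -/
theorem isLittleO_pow_succ_of_hasDerivAt {u u' : ℝ → E → E} {x₀ : E} {n : ℕ}
    (hu0 : ∀ c, u 0 c = 0) (hu : ∀ s c, HasDerivAt (fun s => u s c) (u' s c) s)
    (h : (fun p : ℝ × E => u' p.1 p.2) =o[𝓝 (0, x₀)] fun p => p.1 ^ n) :
    (fun p : ℝ × E => u p.1 p.2) =o[𝓝 (0, x₀)] fun p => p.1 ^ (n + 1) := by
  refine IsLittleO.of_bound fun ε hε => ?_
  obtain ⟨δ, hδ, hb⟩ := Metric.eventually_nhds_iff_ball.1 (h.bound hε)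
  filter_upwards [ball_mem_nhds _ hδ] with ⟨s, c⟩ hp
  have key := (convex_closedBall (0 : ℝ) |s|).norm_image_sub_le_of_norm_hasDerivWithin_le
    (f := fun s => u s c) (f' := fun s => u' s c) (C := ε * |s| ^ n) (x := 0) (y := s)
    (fun t _ => (hu t c).hasDerivWithinAt) (fun t ht => ?_) (by simp) (by simp)
  · simpa [hu0, pow_succ, mul_assoc] using key
  · have ht' : |t| ≤ |s| := by simpa using ht
    have hmem : (t, c) ∈ ball ((0 : ℝ), x₀) δ := by
      simp only [mem_ball, Prod.dist_eq, max_lt_iff, dist_zero_right, Real.norm_eq_abs] at hp ⊢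
      exact ⟨ht'.trans_lt hp.1, hp.2⟩
    refine (hb _ hmem).trans ?_
    simp only [norm_pow, Real.norm_eq_abs]
    gcongr

/-- Second-order Taylor expansion in time of a flow, uniform in the starting point. -/
theorem isLittleO_flow_sub_taylor {X : E → E} {X' : E →L[ℝ] E} {φ : ℝ → E → E}
    (hφ0 : ∀ x, φ 0 x = x) (hφ : ∀ t x, HasDerivAt (fun s => φ s x) (X (φ t x)) t)
    {x₀ : E} (hX : HasStrictFDerivAt X X' x₀) :
    (fun p : ℝ × E => φ p.1 p.2 - p.2 - p.1 • X p.2 - (p.1 ^ 2 / 2) • X' (X x₀))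
      =o[𝓝 (0, x₀)] fun p => p.1 ^ 2 := by
  have hO := isBigO_flow_sub hφ0 hφ hX.continuousAt
  have hsnd : Tendsto (fun p : ℝ × E => p.2) (𝓝 (0, x₀)) (𝓝 x₀) := continuousAt_snd
  have hφt : Tendsto (fun p : ℝ × E => φ p.1 p.2) (𝓝 (0, x₀)) (𝓝 x₀) := by
    have h0 := hO.trans_tendsto (continuousAt_fst (p := ((0 : ℝ), x₀)))
    simpa using h0.add hsnd
  have h1 : (fun p : ℝ × E => φ p.1 p.2 - p.2 - p.1 • X x₀) =o[𝓝 (0, x₀)]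
      fun p => p.1 := by
    have := isLittleO_pow_succ_of_hasDerivAt (n := 0) (x₀ := x₀)
      (u := fun s c => φ s c - c - s • X x₀) (u' := fun s c => X (φ s c) - X x₀)
      (by simp [hφ0])
      (fun s c => by
        simpa using ((hφ s c).sub_const c).fun_sub ((hasDerivAt_id s).smul_const (X x₀)))
      (by
        simp only [pow_zero]
        rw [isLittleO_one_iff]
        simpa using (hX.continuousAt.tendsto.comp hφt).sub_const (X x₀))
    simpa using this
  refine isLittleO_pow_succ_of_hasDerivAt (n := 1) (x₀ := x₀)
      (u := fun s c => φ s c - c - s • X c - (s ^ 2 / 2) • X' (X x₀))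
      (u' := fun s c => X (φ s c) - X c - s • X' (X x₀)) (by simp [hφ0]) (fun s c => ?_) ?_
  · have hsq : HasDerivAt (fun s : ℝ => s ^ 2 / 2) s s := by
      simpa using (hasDerivAt_pow 2 s).div_const 2
    simpa using (((hφ s c).sub_const c).fun_sub ((hasDerivAt_id s).smul_const (X c))).fun_sub
      (hsq.smul_const (X' (X x₀)))
  · have h2 := (hX.isLittleO.comp_tendsto (hφt.prodMk_nhds hsnd)).trans_isBigO hO
    have h3 := (X'.isBigO_comp (fun p : ℝ × E => φ p.1 p.2 - p.2 - p.1 • X x₀)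
      (𝓝 (0, x₀))).trans_isLittleO h1
    simp only [pow_one]
    refine (h2.add h3).congr_left fun p => ?_
    simp only [Function.comp_apply, map_sub, map_smul]
    abel

/-- Effect of a flow for time `σ * t` on the second-order expansion of a curve through `x₀`. -/
theorem isLittleO_flow_comp_expansion {X : E → E} {X' : E →L[ℝ] E} {φ : ℝ → E → E}
    (hφ0 : ∀ x, φ 0 x = x) (hφ : ∀ t x, HasDerivAt (fun s => φ s x) (X (φ t x)) t)
    {x₀ : E} (hX : HasStrictFDerivAt X X' x₀) {c : ℝ → E} {w z : E} (σ : ℝ)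
    (hc : (fun t => c t - (x₀ + t • w + t ^ 2 • z)) =o[𝓝 0] fun t : ℝ => t ^ 2) :
    (fun t => φ (σ * t) (c t) - (x₀ + t • (w + σ • X x₀) +
      t ^ 2 • (z + σ • X' w + (σ ^ 2 / 2) • X' (X x₀)))) =o[𝓝 0] fun t : ℝ => t ^ 2 := by
  have hsq : (fun t : ℝ => t ^ 2) =o[𝓝 0] fun t : ℝ => t := by
    simpa using isLittleO_pow_pow (𝕜 := ℝ) one_lt_two
  have hc1 : (fun t => c t - x₀ - t • w) =o[𝓝 0] fun t : ℝ => t := by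
    have hz : (fun t : ℝ => t ^ 2 • z) =o[𝓝 0] fun t : ℝ => t := by
      simpa using hsq.smul_isBigO (isBigO_refl (fun _ : ℝ => z) _) |>.trans_isBigO
        (isBigO_of_le' (c := ‖z‖) _ fun t => by simp [norm_smul, mul_comm])
    exact ((hc.trans hsq).add hz).congr_left fun t => by abel
  have hcO : (fun t => c t - x₀) =O[𝓝 0] fun t : ℝ => t := by
    have hw : (fun t : ℝ => t • w) =O[𝓝 0] fun t : ℝ => t :=
      isBigO_of_le' (c := ‖w‖) _ fun t => by simp [norm_smul, mul_comm]
    exact (hc1.isBigO.add hw).congr_left fun t => by abel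
  have hct : Tendsto c (𝓝 0) (𝓝 x₀) := by
    have := (hcO.trans_tendsto tendsto_id).add_const x₀
    simpa using this
  have hσt : Tendsto (fun t : ℝ => σ * t) (𝓝 0) (𝓝 0) := by
    simpa using (tendsto_id (α := ℝ) (x := 𝓝 0)).const_mul σ
  have hσO : (fun t : ℝ => (σ * t) ^ 2) =O[𝓝 0] fun t : ℝ => t ^ 2 := by
    simpa only [mul_pow] using isBigO_const_mul_self (σ ^ 2) (fun t : ℝ => t ^ 2) (𝓝 0)
  have h1 := ((isLittleO_flow_sub_taylor hφ0 hφ hX).comp_tendsto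
    (hσt.prodMk_nhds hct)).trans_isBigO hσO
  have h2 : (fun t => X (c t) - X x₀ - t • X' w) =o[𝓝 0] fun t : ℝ => t := by
    have ha := (hX.hasFDerivAt.isLittleO.comp_tendsto hct).trans_isBigO hcO
    have hb := (X'.isBigO_comp (fun t => c t - x₀ - t • w) (𝓝 0)).trans_isLittleO hc1
    refine (ha.add hb).congr_left fun t => ?_
    simp only [Function.comp_apply, map_sub, map_smul]
    abel
  have h3 : (fun t : ℝ => (σ * t) • (X (c t) - X x₀ - t • X' w)) =o[𝓝 0]
      fun t : ℝ => t ^ 2 := by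
    simpa [pow_two] using (isBigO_const_mul_self σ (fun t : ℝ => t) (𝓝 0)).smul_isLittleO h2
  refine ((h1.add h3).add hc).congr_left fun t => ?_
  simp only [Function.comp_apply]
  module

end FlowExpansion

/-- **Commutator-of-flows expansion** (inductive step of the Chow-type lemma): if `φ`, `ψ`
are the global flows of smooth vector fields `X`, `Y` on `ℝ^m`, then for any smooth `f`
and any `x₀`,
`f(ψ_t ∘ φ_t ∘ ψ_{-t} ∘ φ_{-t}(x₀)) = f(x₀) + t² Df(x₀)[[X,Y](x₀)] + o(t²)` as `t → 0`,
with `[X,Y](x₀) = DY(x₀)X(x₀) − DX(x₀)Y(x₀)`. -/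
theorem commutator_of_flows_expansion (m : ℕ)
    (X Y : EuclideanSpace ℝ (Fin m) → EuclideanSpace ℝ (Fin m))
    (hX : ContDiff ℝ ∞ X) (hY : ContDiff ℝ ∞ Y)
    (φ ψ : ℝ → EuclideanSpace ℝ (Fin m) → EuclideanSpace ℝ (Fin m))
    (hφ0 : ∀ x, φ 0 x = x)
    (hφ : ∀ t x, HasDerivAt (fun s => φ s x) (X (φ t x)) t)
    (hψ0 : ∀ x, ψ 0 x = x)
    (hψ : ∀ t x, HasDerivAt (fun s => ψ s x) (Y (ψ t x)) t)
    (f : EuclideanSpace ℝ (Fin m) → ℝ) (hf : ContDiff ℝ ∞ f)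
    (x₀ : EuclideanSpace ℝ (Fin m)) :
    (fun t : ℝ => f (ψ t (φ t (ψ (-t) (φ (-t) x₀)))) - f x₀ -
        t ^ 2 * fderiv ℝ f x₀ (fderiv ℝ Y x₀ (X x₀) - fderiv ℝ X x₀ (Y x₀)))
      =o[nhds 0] fun t : ℝ => t ^ 2 := by
  have hXs := (hX.contDiffAt (x := x₀)).hasStrictFDerivAt (by simp)
  have hYs := (hY.contDiffAt (x := x₀)).hasStrictFDerivAt (by simp)
  set X' := fderiv ℝ X x₀
  set Y' := fderiv ℝ Y x₀
  have h0 : (fun t : ℝ => x₀ - (x₀ + t • (0 : EuclideanSpace ℝ (Fin m)) +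
      t ^ 2 • (0 : EuclideanSpace ℝ (Fin m)))) =o[𝓝 0] fun t : ℝ => t ^ 2 := by
    simp
  have h4 := isLittleO_flow_comp_expansion hψ0 hψ hYs 1 <|
    isLittleO_flow_comp_expansion hφ0 hφ hXs 1 <|
    isLittleO_flow_comp_expansion hψ0 hψ hYs (-1) <|
    isLittleO_flow_comp_expansion hφ0 hφ hXs (-1) h0
  simp only [neg_mul, one_mul] at h4
  set c : ℝ → EuclideanSpace ℝ (Fin m) := fun t => ψ t (φ t (ψ (-t) (φ (-t) x₀)))
  set b := Y' (X x₀) - X' (Y x₀) with hb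
  have hc : (fun t => c t - x₀ - t ^ 2 • b) =o[𝓝 0] fun t : ℝ => t ^ 2 := by
    refine h4.congr_left fun t => ?_
    simp only [hb, map_add, map_smul, map_zero]
    module
  have hcO : (fun t => c t - x₀) =O[𝓝 0] fun t : ℝ => t ^ 2 := by
    have hbO : (fun t : ℝ => t ^ 2 • b) =O[𝓝 0] fun t : ℝ => t ^ 2 :=
      isBigO_of_le' (c := ‖b‖) _ fun t => by simp [norm_smul, mul_comm]
    exact (hc.isBigO.add hbO).congr_left fun t => by abel
  have hct : Tendsto c (𝓝 0) (𝓝 x₀) := by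
    have hsq : Tendsto (fun t : ℝ => t ^ 2) (𝓝 0) (𝓝 0) := by
      simpa using (continuous_pow (M := ℝ) 2).tendsto 0
    simpa using (hcO.trans_tendsto hsq).add_const x₀
  have hfd := (hf.differentiable (by simp) x₀).hasFDerivAt
  have hA := (hfd.isLittleO.comp_tendsto hct).trans_isBigO hcO
  have hB := ((fderiv ℝ f x₀).isBigO_comp (fun t => c t - x₀ - t ^ 2 • b)
    (𝓝 0)).trans_isLittleO hc
  refine (hA.add hB).congr_left fun t => ?_
  simp only [Function.comp_apply, map_sub (fderiv ℝ f x₀), map_smul, smul_eq_mul]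
  ring
end
end

section
/- Let g₁, …, gₙ : ℝ^m → ℝ^m be smooth vector fields each admitting a global flow φ^i : ℝ × ℝ^m → ℝ^m (φ^i(0,x) = x and ∂_t φ^i(t,x) = gᵢ(φ^i(t,x)) for all (t,x)). Fix k ≥ 1 and indices i₁, …, i_k ∈ {1,…,n}. Then there exist a natural number L, indices j₁, …, j_L ∈ {1,…,n}, and real numbers s₁, …, s_L such that for every smooth function f : ℝ^m → ℝ and every x₀ ∈ ℝ^m, f(φ^{j_L}(ε s_L, ·) ∘ ⋯ ∘ φ^{j_1}(ε s_1, ·)(x₀)) = f(x₀) + ε^k · Df(x₀)[(ad_{g_{i₁}} ⋯ ad_{g_{i_{k−1}}} g_{i_k})(x₀)] + o(ε^k) as ε → 0. Here ad_V W = [V,W] is the Lie bracket of vector fields, [V,W](x) = DW(x)V(x) − DV(x)W(x). -/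
open Asymptotics ContDiff

noncomputable section

/-- The Lie bracket of vector fields on `ℝ^m`:
`[V,W](x) = DW(x)V(x) − DV(x)W(x)`. -/
def lieBracketVF {m : ℕ}
    (V W : EuclideanSpace ℝ (Fin m) → EuclideanSpace ℝ (Fin m)) :
    EuclideanSpace ℝ (Fin m) → EuclideanSpace ℝ (Fin m) :=
  fun x => fderiv ℝ W x (V x) - fderiv ℝ V x (W x)

/-- The iterated Lie bracket `ad_{g_{i₁}} ⋯ ad_{g_{i_{k−1}}} g_{i_k}` associated to a
list `[i₁, …, i_k]` of indices. -/
def iterBracket {m n : ℕ}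
    (g : Fin n → EuclideanSpace ℝ (Fin m) → EuclideanSpace ℝ (Fin m)) :
    List (Fin n) → (EuclideanSpace ℝ (Fin m) → EuclideanSpace ℝ (Fin m))
  | [] => fun _ => 0
  | [i] => g i
  | i :: l => lieBracketVF (g i) (iterBracket g l)

section ScaledExp

open PowerSeries

variable {R : Type*} [Ring R]

/-- The group commutator of `P = 1 + X P'` and `W = 1 + X ^ k W'` is
`1 + X ^ (k + 1) [P', W'] + ⋯`. -/
theorem exists_group_commutator_eq {P Q W Z P' W' : PowerSeries R} {k : ℕ}
    (hPQ : P * Q = 1) (hWZ : W * Z = 1) (hQ : constantCoeff Q = 1) (hZ : constantCoeff Z = 1)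
    (hP : P = 1 + X * P') (hW : W = 1 + X ^ k * W') :
    ∃ U : PowerSeries R, P * W * Q * Z = 1 + X ^ (k + 1) * U ∧
      constantCoeff U = constantCoeff P' * constantCoeff W' -
        constantCoeff W' * constantCoeff P' := by
  refine ⟨(P' * W' - W' * P') * Q * Z, ?_, by simp [hQ, hZ]⟩
  have h : P * W - W * P = X ^ (k + 1) * (P' * W' - W' * P') := by
    have h1 : X * P' * (X ^ k * W') = X ^ (k + 1) * (P' * W') := by
      rw [← mul_assoc, mul_assoc X P', (commute_X_pow P' k).eq, ← mul_assoc, ← pow_succ',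
        mul_assoc]
    have h2 : X ^ k * W' * (X * P') = X ^ (k + 1) * (W' * P') := by
      rw [← mul_assoc, mul_assoc _ W', (commute_X W').eq, ← mul_assoc, ← pow_succ, mul_assoc]
    rw [hP, hW, mul_sub, ← h1, ← h2]
    noncomm_ring
  calc P * W * Q * Z = (P * W - W * P) * Q * Z + W * (P * Q) * Z := by noncomm_ring
    _ = 1 + X ^ (k + 1) * ((P' * W' - W' * P') * Q * Z) := by
      rw [h, hPQ, mul_one, hWZ, add_comm]
      simp only [mul_assoc]

variable [Algebra ℝ R]

/-- The formal power series `exp (s A X)` over an `ℝ`-algebra. -/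
def scaledExp (s : ℝ) (A : R) : PowerSeries R :=
  PowerSeries.mk fun r => (s ^ r / (r.factorial : ℝ)) • A ^ r

theorem constantCoeff_scaledExp (s : ℝ) (A : R) :
    constantCoeff (scaledExp s A) = 1 := by
  rw [← coeff_zero_eq_constantCoeff_apply]
  simp [scaledExp]

theorem scaledExp_mul_scaledExp_neg (s : ℝ) (A : R) :
    scaledExp s A * scaledExp (-s) A = 1 := by
  ext d
  have h : ∑ p ∈ Finset.HasAntidiagonal.antidiagonal d,
      (s ^ p.1 / (p.1.factorial : ℝ)) * ((-s) ^ p.2 / (p.2.factorial : ℝ)) =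
        (s + -s) ^ d / (d.factorial : ℝ) := by
    rw [(Commute.all s (-s)).add_pow', Finset.sum_div]
    refine Finset.sum_congr rfl fun p hp => ?_
    obtain rfl := Finset.HasAntidiagonal.mem_antidiagonal.1 hp
    have h3 : ((p.1 + p.2).choose p.1 : ℝ) * p.1.factorial * p.2.factorial =
        (p.1 + p.2).factorial := by
      rw [Nat.choose_symm_add]
      exact_mod_cast Nat.add_choose_mul_factorial_mul_factorial p.1 p.2
    rw [nsmul_eq_mul, ← h3]
    have := (Nat.choose_pos (Nat.le_add_right p.1 p.2)).ne'
    field_simp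
  rw [coeff_mul]
  simp only [scaledExp, coeff_mk, smul_mul_smul_comm, ← pow_add]
  rw [Finset.sum_congr rfl fun p hp => by rw [Finset.HasAntidiagonal.mem_antidiagonal.1 hp],
    ← Finset.sum_smul, h, coeff_one]
  rcases eq_or_ne d 0 with rfl | hd
  · simp
  · simp [hd]

theorem exists_scaledExp_one_eq (A : R) :
    ∃ U : PowerSeries R, scaledExp 1 A = 1 + X * U ∧ constantCoeff U = A := by
  refine ⟨PowerSeries.mk fun r => coeff (r + 1) (scaledExp 1 A), ?_, ?_⟩
  · ext (_ | d)
    · simp [constantCoeff_scaledExp]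
    · simp [coeff_succ_X_mul, coeff_one]
  · rw [← coeff_zero_eq_constantCoeff_apply]
    simp [scaledExp]

variable {ι : Type*}

/-- The product of the formal exponentials attached to a word of pairs (index, time). -/
def wordSeries (A : ι → R) (w : List (ι × ℝ)) : PowerSeries R :=
  (w.map fun p => scaledExp p.2 (A p.1)).prod

theorem wordSeries_append (A : ι → R) (v w : List (ι × ℝ)) :
    wordSeries A (v ++ w) = wordSeries A v * wordSeries A w := by
  simp [wordSeries]

theorem wordSeries_singleton (A : ι → R) (p : ι × ℝ) :
    wordSeries A [p] = scaledExp p.2 (A p.1) := by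
  simp [wordSeries]

theorem constantCoeff_wordSeries (A : ι → R) (w : List (ι × ℝ)) :
    constantCoeff (wordSeries A w) = 1 := by
  induction w with
  | nil => simp [wordSeries]
  | cons p w ih =>
    rw [← List.singleton_append, wordSeries_append, map_mul, ih, wordSeries_singleton,
      constantCoeff_scaledExp, one_mul]

/-- The word run backwards. -/
def reverseWord (w : List (ι × ℝ)) : List (ι × ℝ) :=
  (w.map fun p => (p.1, -p.2)).reverse

theorem wordSeries_mul_reverseWord (A : ι → R) (w : List (ι × ℝ)) :
    wordSeries A w * wordSeries A (reverseWord w) = 1 := by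
  induction w with
  | nil => simp [wordSeries, reverseWord]
  | cons p w ih =>
    have h : reverseWord (p :: w) = reverseWord w ++ [(p.1, -p.2)] := by simp [reverseWord]
    rw [h, ← List.singleton_append, wordSeries_append, wordSeries_append, mul_assoc,
      ← mul_assoc (wordSeries A w), ih, one_mul, wordSeries_singleton, wordSeries_singleton,
      scaledExp_mul_scaledExp_neg]

end ScaledExp

section SmoothFunctions

variable {E : Type*} [NormedAddCommGroup E] [NormedSpace ℝ E]

variable (E) in
/-- The space of smooth real functions on `E`. -/
def smoothFunctions : Submodule ℝ (E → ℝ) where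
  carrier := {f | ContDiff ℝ ∞ f}
  add_mem' {f h} (hf : ContDiff ℝ ∞ f) (hh : ContDiff ℝ ∞ h) := hf.add hh
  zero_mem' := show ContDiff ℝ ∞ fun _ : E => (0 : ℝ) from contDiff_const
  smul_mem' c f (hf : ContDiff ℝ ∞ f) := hf.const_smul c

theorem contDiff_coe (f : smoothFunctions E) : ContDiff ℝ ∞ (f : E → ℝ) := f.2

theorem differentiable_coe (f : smoothFunctions E) :
    Differentiable ℝ (f : E → ℝ) :=
  (contDiff_coe f).differentiable (by simp)

/-- The derivation of the space of smooth functions given by a smooth vector field. -/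
def lieDerivative (V : E → E) (hV : ContDiff ℝ ∞ V) : Module.End ℝ (smoothFunctions E) where
  toFun f := ⟨fun x => fderiv ℝ (f : E → ℝ) x (V x), show ContDiff ℝ ∞ _ from
    ((contDiff_coe f).fderiv_right (m := ∞) (by simp)).clm_apply hV⟩
  map_add' f h := by
    ext x
    simp [fderiv_add (differentiable_coe f x) (differentiable_coe h x)]
  map_smul' c f := by
    ext x
    simp [fderiv_const_smul (differentiable_coe f x)]

theorem lieDerivative_apply (V : E → E) (hV : ContDiff ℝ ∞ V) (f : smoothFunctions E) (x : E) :
    (lieDerivative V hV f : E → ℝ) x = fderiv ℝ f x (V x) := rfl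

theorem fderiv_lieDerivative (V : E → E) (hV : ContDiff ℝ ∞ V) (f : smoothFunctions E) (x v : E) :
    fderiv ℝ (lieDerivative V hV f : E → ℝ) x v =
      fderiv ℝ (fderiv ℝ f) x v (V x) + fderiv ℝ f x (fderiv ℝ V x v) := by
  have h1 : DifferentiableAt ℝ (fderiv ℝ (f : E → ℝ)) x :=
    ((contDiff_coe f).fderiv_right (m := ∞) (by simp)).differentiable (by simp) x
  have h2 : DifferentiableAt ℝ V x := hV.differentiable (by simp) x
  have h3 := (h1.hasFDerivAt.clm_apply h2.hasFDerivAt).fderiv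
  change fderiv ℝ (fun y => fderiv ℝ (f : E → ℝ) y (V y)) x v = _
  rw [h3]
  simp [add_comm]

end SmoothFunctions

theorem contDiff_lieBracketVF {m : ℕ}
    {V W : EuclideanSpace ℝ (Fin m) → EuclideanSpace ℝ (Fin m)}
    (hV : ContDiff ℝ ∞ V) (hW : ContDiff ℝ ∞ W) : ContDiff ℝ ∞ (lieBracketVF V W) :=
  ((hW.fderiv_right (m := ∞) (by simp)).clm_apply hV).sub
    ((hV.fderiv_right (m := ∞) (by simp)).clm_apply hW)

theorem lieDerivative_lieBracketVF {m : ℕ}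
    {V W : EuclideanSpace ℝ (Fin m) → EuclideanSpace ℝ (Fin m)}
    (hV : ContDiff ℝ ∞ V) (hW : ContDiff ℝ ∞ W) :
    lieDerivative V hV * lieDerivative W hW - lieDerivative W hW * lieDerivative V hV =
      lieDerivative (lieBracketVF V W) (contDiff_lieBracketVF hV hW) := by
  ext f x
  have hs : IsSymmSndFDerivAt ℝ (f : EuclideanSpace ℝ (Fin m) → ℝ) x :=
    (contDiff_coe f).contDiffAt.isSymmSndFDerivAt
      (by simpa using WithTop.coe_le_coe.2 (le_top (a := (2 : ℕ∞))))
  have h := hs.eq (V x) (W x)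
  simp only [LinearMap.sub_apply, Module.End.mul_apply, Submodule.coe_sub, Pi.sub_apply,
    lieDerivative_apply, fderiv_lieDerivative, lieBracketVF, map_sub, h]
  ring

theorem contDiff_iterBracket {m n : ℕ}
    {g : Fin n → EuclideanSpace ℝ (Fin m) → EuclideanSpace ℝ (Fin m)}
    (hg : ∀ i, ContDiff ℝ ∞ (g i)) : ∀ l : List (Fin n), ContDiff ℝ ∞ (iterBracket g l)
  | [] => contDiff_const
  | [i] => hg i
  | i :: j :: l => contDiff_lieBracketVF (hg i) (contDiff_iterBracket hg (j :: l))

theorem exists_wordSeries_eq {m n : ℕ}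
    {g : Fin n → EuclideanSpace ℝ (Fin m) → EuclideanSpace ℝ (Fin m)}
    (hg : ∀ i, ContDiff ℝ ∞ (g i)) : ∀ l : List (Fin n), l ≠ [] →
    ∃ (w : List (Fin n × ℝ)) (U : PowerSeries (Module.End ℝ (smoothFunctions _))),
      wordSeries (fun i => lieDerivative (g i) (hg i)) w = 1 + PowerSeries.X ^ l.length * U ∧
      PowerSeries.constantCoeff U = lieDerivative (iterBracket g l) (contDiff_iterBracket hg l)
  | [], h => absurd rfl h
  | [i], _ => by
    obtain ⟨U, hU, hU0⟩ := exists_scaledExp_one_eq (lieDerivative (g i) (hg i))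
    exact ⟨[(i, 1)], U, by simpa [wordSeries_singleton] using hU, hU0⟩
  | i :: j :: l, _ => by
    obtain ⟨w, W', hw, hW'⟩ := exists_wordSeries_eq hg (j :: l) (by simp)
    obtain ⟨P', hP, hP'⟩ := exists_scaledExp_one_eq (lieDerivative (g i) (hg i))
    obtain ⟨U, hU, hU0⟩ := exists_group_commutator_eq
      (scaledExp_mul_scaledExp_neg 1 (lieDerivative (g i) (hg i)))
      (wordSeries_mul_reverseWord (fun i => lieDerivative (g i) (hg i)) w)
      (constantCoeff_scaledExp _ _) (constantCoeff_wordSeries _ _) hP hw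
    refine ⟨[(i, 1)] ++ w ++ [(i, -1)] ++ reverseWord w, U, ?_, ?_⟩
    · rw [wordSeries_append, wordSeries_append, wordSeries_append, wordSeries_singleton,
        wordSeries_singleton]
      exact hU
    · rw [hU0, hP', hW', lieDerivative_lieBracketVF]
      rfl

section Flow

open Filter Topology

variable {E : Type*} [NormedAddCommGroup E]

/-- A function vanishing at time `0` whose time derivative is `O(t ^ N)`, locally uniformly in a
parameter, is `O(t ^ (N + 1))`. -/
theorem isBigO_pow_succ_of_hasDerivAt {F F' : ℝ → E → ℝ} {x₀ : E} {N : ℕ}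
    (h0 : ∀ x, F 0 x = 0) (hF : ∀ t x, HasDerivAt (fun s => F s x) (F' t x) t)
    (hF' : (fun p : ℝ × E => F' p.1 p.2) =O[𝓝 (0, x₀)] fun p => p.1 ^ N) :
    (fun p : ℝ × E => F p.1 p.2) =O[𝓝 (0, x₀)] fun p => p.1 ^ (N + 1) := by
  obtain ⟨C, hC0, hC⟩ := hF'.exists_nonneg
  obtain ⟨δ, hδ, h⟩ := Metric.eventually_nhds_iff.1 hC.bound
  refine IsBigO.of_bound C (Metric.eventually_nhds_iff.2 ⟨δ, hδ, ?_⟩)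
  rintro ⟨t, x⟩ hp
  rw [Prod.dist_eq, max_lt_iff, dist_zero_right] at hp
  have hb : ∀ s ∈ Metric.closedBall (0 : ℝ) ‖t‖, ‖F' s x‖ ≤ C * ‖t‖ ^ N := fun s hs => by
    rw [mem_closedBall_zero_iff] at hs
    have h1 := @h (s, x) (by
      rw [Prod.dist_eq, max_lt_iff, dist_zero_right]
      exact ⟨hs.trans_lt hp.1, hp.2⟩)
    rw [norm_pow] at h1
    exact h1.trans (by dsimp only; gcongr)
  have := Convex.norm_image_sub_le_of_norm_hasDerivWithin_le
    (fun s _ => (hF s x).hasDerivWithinAt) hb (convex_closedBall _ _)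
    (Metric.mem_closedBall_self (norm_nonneg t)) (mem_closedBall_zero_iff.2 (le_refl ‖t‖))
  simpa [h0, pow_succ, mul_assoc] using this

variable [NormedSpace ℝ E]

theorem norm_integralCurve_sub_le {V : E → E} {c : ℝ → E} {x₀ : E} {ρ r M T : ℝ}
    (hV : ∀ x, ‖x - x₀‖ ≤ r → ‖V x‖ < M) (hM : 0 ≤ M)
    (hc : ∀ t, HasDerivAt c (V (c t)) t)
    (h0 : ‖c 0 - x₀‖ ≤ ρ) (hT : ρ + M * T ≤ r) :
    ∀ t ∈ Set.Icc 0 T, ‖c t - x₀‖ ≤ r := by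
  have hB : ∀ t ∈ Set.Icc 0 T, ρ + M * t ≤ r := fun t ht => by
    nlinarith [mul_le_mul_of_nonneg_left ht.2 hM]
  intro t ht
  refine le_trans ?_ (hB t ht)
  refine image_norm_le_of_norm_deriv_right_lt_deriv_boundary
    (f := fun t => c t - x₀) (f' := fun t => V (c t)) (B := fun t => ρ + M * t)
    (B' := fun _ => M) (a := 0) (b := T) ?_ ?_ (by simpa using h0) ?_ ?_ ht
  · exact fun s _ => ((hc s).sub_const x₀).continuousAt.continuousWithinAt
  · exact fun s _ => ((hc s).sub_const x₀).hasDerivWithinAt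
  · intro s
    simpa using ((hasDerivAt_id s).const_mul M).const_add ρ
  · exact fun s hs he => hV _ (he.trans_le (hB s ⟨hs.1, hs.2.le⟩))

theorem continuousAt_flow {V : E → E} (hV : Continuous V) {Φ : ℝ → E → E}
    (hΦ0 : ∀ x, Φ 0 x = x) (hΦ : ∀ t x, HasDerivAt (fun s => Φ s x) (V (Φ t x)) t) (x₀ : E) :
    Tendsto (fun p : ℝ × E => Φ p.1 p.2) (𝓝 (0, x₀)) (𝓝 x₀) := by
  rw [Metric.tendsto_nhds]
  intro η hη
  set M := ‖V x₀‖ + 1 with hMdef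
  have hM : 0 < M := by positivity
  obtain ⟨δ, hδ, hVδ⟩ : ∃ δ > 0, ∀ x, ‖x - x₀‖ < δ → ‖V x‖ < M := by
    have h : ∀ᶠ x in 𝓝 x₀, ‖V x‖ < M :=
      hV.norm.continuousAt.eventually_lt continuousAt_const (by simp [hMdef])
    obtain ⟨δ, hδ, h⟩ := Metric.eventually_nhds_iff.1 h
    exact ⟨δ, hδ, fun x hx => h (by rwa [dist_eq_norm])⟩
  set r := min η δ / 2 with hr
  have hr0 : 0 < r := by positivity
  have hrη : r < η := by have := min_le_left η δ; rw [hr]; linarith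
  have hrδ : r < δ := by have := min_le_right η δ; rw [hr]; linarith
  have hVr : ∀ x, ‖x - x₀‖ ≤ r → ‖V x‖ < M := fun x hx => hVδ x (hx.trans_lt hrδ)
  have hT : r / 2 + M * (r / (2 * M)) ≤ r := by
    have : M * (r / (2 * M)) = r / 2 := by field_simp
    linarith
  rw [nhds_prod_eq]
  filter_upwards [prod_mem_prod (Metric.closedBall_mem_nhds (0 : ℝ) (ε := r / (2 * M))
    (by positivity)) (Metric.closedBall_mem_nhds x₀ (half_pos hr0))] with p hp
  obtain ⟨ht, hx⟩ := hp
  rw [mem_closedBall_zero_iff, Real.norm_eq_abs, abs_le] at ht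
  rw [Metric.mem_closedBall, dist_eq_norm] at hx
  rw [dist_eq_norm]
  refine lt_of_le_of_lt ?_ hrη
  rcases le_total 0 p.1 with h0 | h0
  · exact norm_integralCurve_sub_le hVr hM.le (fun t => hΦ t p.2) (by simpa [hΦ0] using hx) hT
      p.1 ⟨h0, ht.2⟩
  · have hc : ∀ t, HasDerivAt (fun t => Φ (-t) p.2) (-V (Φ (-t) p.2)) t := fun t => by
      simpa [Function.comp_def] using (hΦ (-t) p.2).scomp t (hasDerivAt_neg t)
    simpa using norm_integralCurve_sub_le (V := fun x => -V x) (c := fun t => Φ (-t) p.2)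
      (by simpa using hVr) hM.le hc (by simpa [hΦ0] using hx) hT
      (-p.1) ⟨by linarith, by linarith [ht.1]⟩

theorem isBigO_comp_flow_sub_taylor {V : E → E} (hV : ContDiff ℝ ∞ V) {Φ : ℝ → E → E}
    (hΦ0 : ∀ x, Φ 0 x = x) (hΦ : ∀ t x, HasDerivAt (fun s => Φ s x) (V (Φ t x)) t) (x₀ : E)
    (N : ℕ) (f : smoothFunctions E) :
    (fun p : ℝ × E => (f : E → ℝ) (Φ p.1 p.2) - ∑ r ∈ Finset.range N,
      p.1 ^ r / (r.factorial : ℝ) * ((lieDerivative V hV ^ r) f : E → ℝ) p.2)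
      =O[𝓝 (0, x₀)] fun p => p.1 ^ N := by
  induction N generalizing f with
  | zero =>
    simpa using ((contDiff_coe f).continuous.continuousAt.tendsto.comp
      (continuousAt_flow hV.continuous hΦ0 hΦ x₀)).isBigO_one ℝ
  | succ N ih =>
    refine isBigO_pow_succ_of_hasDerivAt (F := fun t x => (f : E → ℝ) (Φ t x) -
      ∑ r ∈ Finset.range (N + 1),
        t ^ r / (r.factorial : ℝ) * ((lieDerivative V hV ^ r) f : E → ℝ) x)
      (F' := fun t x => (lieDerivative V hV f : E → ℝ) (Φ t x) - ∑ r ∈ Finset.range N,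
        t ^ r / (r.factorial : ℝ) *
          ((lieDerivative V hV ^ r) (lieDerivative V hV f) : E → ℝ) x)
      (fun x => ?_) (fun t x => ?_) (ih (lieDerivative V hV f))
    · rw [Finset.sum_range_succ']
      simp [hΦ0]
    · have h1 : HasDerivAt (fun s => (f : E → ℝ) (Φ s x))
          ((lieDerivative V hV f : E → ℝ) (Φ t x)) t :=
        (differentiable_coe f (Φ t x)).hasFDerivAt.comp_hasDerivAt t (hΦ t x)
      have h2 : HasDerivAt (fun s : ℝ => ∑ r ∈ Finset.range (N + 1),
          s ^ r / (r.factorial : ℝ) * ((lieDerivative V hV ^ r) f : E → ℝ) x)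
          (∑ r ∈ Finset.range N, t ^ r / (r.factorial : ℝ) *
            ((lieDerivative V hV ^ r) (lieDerivative V hV f) : E → ℝ) x) t := by
        simp only [Finset.sum_range_succ' _ N]
        have h3 : ∀ r ∈ Finset.range N, HasDerivAt (fun s : ℝ =>
            s ^ (r + 1) / ((r + 1).factorial : ℝ) *
              ((lieDerivative V hV ^ (r + 1)) f : E → ℝ) x)
            (t ^ r / (r.factorial : ℝ) *
              ((lieDerivative V hV ^ r) (lieDerivative V hV f) : E → ℝ) x) t := fun r _ => by
          refine (((hasDerivAt_pow (r + 1) t).div_const _).mul_const _).congr_deriv ?_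
          rw [pow_succ (lieDerivative V hV), Module.End.mul_apply, Nat.factorial_succ]
          push_cast
          field_simp
        simpa using (HasDerivAt.fun_sum h3).add_const ((f : E → ℝ) x)
      exact h1.sub h2

/-- The curve `y` is asymptotic at `0` to the formal power series of operators `S` at `x₀`,
when tested against smooth functions. -/
def HasExpansion (y : ℝ → E) (x₀ : E) (S : PowerSeries (Module.End ℝ (smoothFunctions E))) :
    Prop :=
  ∀ (f : smoothFunctions E) (N : ℕ),
    (fun ε : ℝ => (f : E → ℝ) (y ε) -
      ∑ q ∈ Finset.range N, ε ^ q * (PowerSeries.coeff q S f : E → ℝ) x₀)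
      =O[𝓝 0] fun ε => ε ^ N

theorem hasExpansion_const (x₀ : E) : HasExpansion (fun _ => x₀) x₀ 1 := by
  rintro f (_ | N)
  · simpa using isBigO_const_const ((f : E → ℝ) x₀) (one_ne_zero (α := ℝ)) (𝓝 (0 : ℝ))
  · rw [show (fun ε : ℝ => (f : E → ℝ) x₀ - ∑ q ∈ Finset.range (N + 1), ε ^ q *
      (PowerSeries.coeff q (1 : PowerSeries (Module.End ℝ (smoothFunctions E))) f : E → ℝ) x₀) =
        fun _ => 0 from ?_]
    · exact isBigO_zero _ _
    · ext ε
      rw [Finset.sum_range_succ']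
      simp [PowerSeries.coeff_one]

theorem tendsto_comp_flow {V : E → E} (hV : Continuous V) {Φ : ℝ → E → E}
    (hΦ0 : ∀ x, Φ 0 x = x) (hΦ : ∀ t x, HasDerivAt (fun s => Φ s x) (V (Φ t x)) t) {x₀ : E}
    {y : ℝ → E} (hy : Tendsto y (𝓝 0) (𝓝 x₀)) (s : ℝ) :
    Tendsto (fun ε => Φ (ε * s) (y ε)) (𝓝 0) (𝓝 x₀) := by
  have h : Tendsto (fun ε : ℝ => ε * s) (𝓝 0) (𝓝 0) := by
    simpa using (continuous_mul_const s).tendsto (0 : ℝ)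
  exact (continuousAt_flow hV hΦ0 hΦ x₀).comp (h.prodMk_nhds hy)

theorem HasExpansion.comp_flow {V : E → E} (hV : ContDiff ℝ ∞ V) {Φ : ℝ → E → E}
    (hΦ0 : ∀ x, Φ 0 x = x) (hΦ : ∀ t x, HasDerivAt (fun s => Φ s x) (V (Φ t x)) t) {x₀ : E}
    {y : ℝ → E} (hy : Tendsto y (𝓝 0) (𝓝 x₀))
    {S : PowerSeries (Module.End ℝ (smoothFunctions E))} (hS : HasExpansion y x₀ S) (s : ℝ) :
    HasExpansion (fun ε => Φ (ε * s) (y ε)) x₀ (S * scaledExp s (lieDerivative V hV)) := by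
  intro f N
  set T := scaledExp s (lieDerivative V hV) with hTdef
  have hε : Tendsto (fun ε : ℝ => ε * s) (𝓝 0) (𝓝 0) := by
    simpa using (continuous_mul_const s).tendsto (0 : ℝ)
  have hpow : ∀ N : ℕ, ((fun p : ℝ × E => p.1 ^ N) ∘ fun ε => (ε * s, y ε)) =O[𝓝 0]
      fun ε : ℝ => ε ^ N := fun N => by
    simpa [Function.comp_def, mul_pow, mul_comm] using
      (isBigO_refl (fun ε : ℝ => ε ^ N) (𝓝 0)).const_mul_left (s ^ N)
  have h1 := ((isBigO_comp_flow_sub_taylor hV hΦ0 hΦ x₀ N f).comp_tendsto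
    (hε.prodMk_nhds hy)).trans (hpow N)
  have h2 : ∀ b ∈ Finset.range N, (fun ε : ℝ => ε ^ b *
      ((PowerSeries.coeff b T f : E → ℝ) (y ε) - ∑ a ∈ Finset.range (N - b),
        ε ^ a * (PowerSeries.coeff a S (PowerSeries.coeff b T f) : E → ℝ) x₀))
      =O[𝓝 0] fun ε => ε ^ N := fun b hb => by
    have := (isBigO_refl (fun ε : ℝ => ε ^ b) (𝓝 0)).mul (hS (PowerSeries.coeff b T f) (N - b))
    simpa only [← pow_add, Nat.add_sub_cancel' (Finset.mem_range.1 hb).le] using this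
  refine (h1.add (IsBigO.sum h2)).congr_left fun ε => ?_
  have h3 : ∀ q, (PowerSeries.coeff q (S * T) f : E → ℝ) x₀ =
      ∑ b ∈ Finset.range (q + 1),
        (PowerSeries.coeff (q - b) S (PowerSeries.coeff b T f) : E → ℝ) x₀ := fun q => by
    rw [PowerSeries.coeff_mul, Finset.Nat.antidiagonal_eq_map', Finset.sum_map]
    simp only [LinearMap.sum_apply, Submodule.coe_sum, Finset.sum_apply, Module.End.mul_apply]
    rfl
  have h4 : ∑ q ∈ Finset.range N, ε ^ q * (PowerSeries.coeff q (S * T) f : E → ℝ) x₀ =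
      ∑ b ∈ Finset.range N, ∑ a ∈ Finset.range (N - b),
        ε ^ b * (ε ^ a * (PowerSeries.coeff a S (PowerSeries.coeff b T f) : E → ℝ) x₀) := by
    rw [← Finset.sum_range_diag_flip N fun b a =>
      ε ^ b * (ε ^ a * (PowerSeries.coeff a S (PowerSeries.coeff b T f) : E → ℝ) x₀)]
    refine Finset.sum_congr rfl fun q _ => ?_
    rw [h3, Finset.mul_sum]
    refine Finset.sum_congr rfl fun b hb => ?_
    rw [← mul_assoc, ← pow_add, Nat.add_sub_cancel' (Finset.mem_range_succ_iff.1 hb)]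
  have h5 : ∀ b, (PowerSeries.coeff b T f : E → ℝ) (y ε) =
      s ^ b / (b.factorial : ℝ) * ((lieDerivative V hV ^ b) f : E → ℝ) (y ε) := fun b => by
    simp [hTdef, scaledExp]
  rw [h4]
  simp only [mul_sub, Finset.sum_apply, Finset.sum_sub_distrib, Function.comp_apply,
    Finset.mul_sum, h5]
  have h6 : ∀ b, (ε * s) ^ b / (b.factorial : ℝ) * ((lieDerivative V hV ^ b) f : E → ℝ) (y ε) =
      ε ^ b * (s ^ b / (b.factorial : ℝ) * ((lieDerivative V hV ^ b) f : E → ℝ) (y ε)) :=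
    fun b => by ring
  simp only [h6]
  ring

/-- The composition of flows prescribed by a word of pairs (index, time). -/
def wordFlow {ι : Type*} (φ : ι → ℝ → E → E) (w : List (ι × ℝ)) (ε : ℝ) (x : E) : E :=
  w.foldl (fun x p => φ p.1 (ε * p.2) x) x

theorem tendsto_wordFlow_and_hasExpansion {ι : Type*} {g : ι → E → E}
    (hg : ∀ i, ContDiff ℝ ∞ (g i)) {φ : ι → ℝ → E → E} (hφ0 : ∀ i x, φ i 0 x = x)
    (hφ : ∀ i t x, HasDerivAt (fun s => φ i s x) (g i (φ i t x)) t) (x₀ : E)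
    (w : List (ι × ℝ)) :
    Tendsto (fun ε => wordFlow φ w ε x₀) (𝓝 0) (𝓝 x₀) ∧
      HasExpansion (fun ε => wordFlow φ w ε x₀) x₀
        (wordSeries (fun i => lieDerivative (g i) (hg i)) w) := by
  induction w using List.reverseRecOn with
  | nil => exact ⟨tendsto_const_nhds, hasExpansion_const x₀⟩
  | append_singleton w p ih =>
    simp only [wordSeries_append, wordSeries_singleton, wordFlow, List.foldl_append,
      List.foldl_cons, List.foldl_nil]
    exact ⟨tendsto_comp_flow (hg p.1).continuous (hφ0 p.1) (hφ p.1) ih.1 p.2,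
      ih.2.comp_flow (hg p.1) (hφ0 p.1) (hφ p.1) ih.1 p.2⟩

end Flow

/-- **Chow-type lemma** (Lemma on piecewise constant controls): given smooth vector
fields `g₁, …, gₙ` with global flows `φ^i`, and indices `i₁, …, i_k`, there is a finite
composition of flows, run for times proportional to `ε`, whose effect on every smooth
test function `f` is
`f(x₀) + ε^k Df(x₀)[(ad_{g_{i₁}} ⋯ ad_{g_{i_{k−1}}} g_{i_k})(x₀)] + o(ε^k)` as `ε → 0`. -/
theorem chow_type_lemma (m n : ℕ)
    (g : Fin n → EuclideanSpace ℝ (Fin m) → EuclideanSpace ℝ (Fin m))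
    (hg : ∀ i, ContDiff ℝ ∞ (g i))
    (φ : Fin n → ℝ → EuclideanSpace ℝ (Fin m) → EuclideanSpace ℝ (Fin m))
    (hφ0 : ∀ i x, φ i 0 x = x)
    (hφ : ∀ i t x, HasDerivAt (fun s => φ i s x) (g i (φ i t x)) t)
    (k : ℕ) (hk : 1 ≤ k) (idx : Fin k → Fin n) :
    ∃ (L : ℕ) (j : Fin L → Fin n) (s : Fin L → ℝ),
      ∀ f : EuclideanSpace ℝ (Fin m) → ℝ, ContDiff ℝ ∞ f →
        ∀ x₀ : EuclideanSpace ℝ (Fin m),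
          (fun ε : ℝ =>
              f ((List.finRange L).foldl (fun x l => φ (j l) (ε * s l) x) x₀) -
                f x₀ - ε ^ k * fderiv ℝ f x₀ (iterBracket g (List.ofFn idx) x₀))
            =o[nhds 0] fun ε : ℝ => ε ^ k := by
  obtain ⟨w, U, hU, hU0⟩ := exists_wordSeries_eq hg (List.ofFn idx) (by
    rw [Ne, List.ofFn_eq_nil_iff]; omega)
  rw [List.length_ofFn] at hU
  refine ⟨w.length, fun l => (w.get l).1, fun l => (w.get l).2, fun f hf x₀ => ?_⟩
  have hfold : ∀ ε : ℝ, (List.finRange w.length).foldl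
      (fun x l => φ (w.get l).1 (ε * (w.get l).2) x) x₀ = wordFlow φ w ε x₀ := fun ε => by
    conv_rhs => rw [wordFlow, ← List.map_get_finRange w, List.foldl_map]
  simp only [hfold]
  have hexp := (tendsto_wordFlow_and_hasExpansion hg hφ0 hφ x₀ w).2 ⟨f, hf⟩ (k + 1)
  refine (hexp.trans_isLittleO (isLittleO_pow_pow k.lt_succ_self)).congr_left fun ε => ?_
  have hlow : ∑ q ∈ Finset.range k, ε ^ q * (PowerSeries.coeff q
      (wordSeries (fun i => lieDerivative (g i) (hg i)) w) ⟨f, hf⟩ : _ → ℝ) x₀ = f x₀ := by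
    rw [Finset.sum_eq_single_of_mem 0 (Finset.mem_range.2 hk) fun q hq hq0 => ?_]
    · have : ¬ k = 0 := by omega
      simp [hU, this]
    · have : ¬ k ≤ q := by simpa using hq
      simp [hU, PowerSeries.coeff_one, hq0, PowerSeries.coeff_X_pow_mul', this]
  have htop : PowerSeries.coeff k (wordSeries (fun i => lieDerivative (g i) (hg i)) w) =
      lieDerivative _ (contDiff_iterBracket hg (List.ofFn idx)) := by
    have : ¬ k = 0 := by omega
    simp [hU, PowerSeries.coeff_one, this, PowerSeries.coeff_X_pow_mul', hU0]
  rw [Finset.sum_range_succ, hlow, htop, lieDerivative_apply]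
  ring
end
end

section
/- Let ν₁, ν₂ be Borel probability measures on M and let 0 < s < T. Then there exists a Borel probability measure ν on M such that C_T(ν₁,ν₂) = C_s(ν₁,ν) + C_{T−s}(ν,ν₂). -/
open MeasureTheory

/-- A coupling of two Borel probability measures: a probability measure on `M × M`
whose first marginal is `μ` and second marginal is `ν`. -/
def IsCoupling {M : Type*} [MeasurableSpace M]
    (P : Measure (M × M)) (μ ν : Measure M) : Prop :=
  P.map Prod.fst = μ ∧ P.map Prod.snd = ν

/-- The Monge–Kantorovich optimal transportation cost `C(μ,ν)`:
the infimum of `∫ c dΠ` over all couplings `Π` of `μ` and `ν`. -/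
noncomputable def transportCost {M : Type*} [MeasurableSpace M]
    (c : M → M → ℝ) (μ ν : Measure M) : ℝ :=
  sInf {r : ℝ | ∃ P : Measure (M × M), IsProbabilityMeasure P ∧ IsCoupling P μ ν ∧
    r = ∫ p, c p.1 p.2 ∂P}

open ProbabilityTheory in
/-- Gluing: two probability measures sharing a marginal are the two-dimensional marginals of a
measure on the triple product. -/
theorem exists_measure_gluing {α β γ : Type*} [MeasurableSpace α] [MeasurableSpace β]
    [MeasurableSpace γ] [StandardBorelSpace γ] [Nonempty γ]
    (P : Measure (α × β)) (Q : Measure (β × γ)) [IsProbabilityMeasure P] [IsProbabilityMeasure Q]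
    (h : P.map Prod.snd = Q.map Prod.fst) :
    ∃ R : Measure ((α × β) × γ), IsProbabilityMeasure R ∧ R.map Prod.fst = P ∧
      R.map (fun p => (p.1.2, p.2)) = Q := by
  refine ⟨P ⊗ₘ (Q.condKernel.comap Prod.snd measurable_snd), inferInstance,
    Measure.fst_compProd _ _, ?_⟩
  have hm : Measurable fun p : (α × β) × γ => (p.1.2, p.2) := by fun_prop
  ext S hS
  rw [Measure.map_apply hm hS, Measure.compProd_apply (hm hS)]
  have hQ : Q S = (Q.fst ⊗ₘ Q.condKernel) S := by rw [Q.disintegrate]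
  rw [hQ, Measure.compProd_apply hS, Measure.fst, ← h,
    lintegral_map (Kernel.measurable_kernel_prodMk_left hS) measurable_snd]
  rfl

/-- A continuous function on a compact space is integrable for every finite measure. -/
theorem Continuous.integrable_of_compactSpace {X : Type*} [TopologicalSpace X] [CompactSpace X]
    [MeasurableSpace X] [OpensMeasurableSpace X] {f : X → ℝ} (hf : Continuous f)
    (P : Measure X) [IsFiniteMeasure P] : Integrable f P :=
  hf.integrable_of_hasCompactSupport (HasCompactSupport.of_compactSpace f)

section Transport

variable {M : Type*} [MetricSpace M] [CompactSpace M] [MeasurableSpace M] [BorelSpace M]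

theorem transportCost_le_integral {c : M → M → ℝ} (hc : Continuous (Function.uncurry c))
    {μ ν : Measure M} (P : Measure (M × M)) [IsProbabilityMeasure P] (hP : IsCoupling P μ ν) :
    transportCost c μ ν ≤ ∫ p, c p.1 p.2 ∂P := by
  obtain ⟨a, ha⟩ := (isCompact_range hc).bddBelow
  refine csInf_le ⟨a, ?_⟩ ⟨P, inferInstance, hP, rfl⟩
  rintro _ ⟨Q, hQ, -, rfl⟩
  calc a = ∫ _, a ∂Q := by simp
    _ ≤ ∫ p, c p.1 p.2 ∂Q :=
      integral_mono (integrable_const a) (hc.integrable_of_compactSpace Q) fun p => ha ⟨p, rfl⟩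

theorem le_transportCost {c : M → M → ℝ} {μ ν : Measure M} [IsProbabilityMeasure μ]
    [IsProbabilityMeasure ν] {a : ℝ}
    (h : ∀ P : Measure (M × M), IsProbabilityMeasure P → IsCoupling P μ ν →
      a ≤ ∫ p, c p.1 p.2 ∂P) :
    a ≤ transportCost c μ ν := by
  refine le_csInf ⟨_, μ.prod ν, inferInstance, ⟨?_, ?_⟩, rfl⟩ ?_
  · simp [Measure.map_fst_prod]
  · simp [Measure.map_snd_prod]
  · rintro _ ⟨P, hP, hP', rfl⟩
    exact h P hP hP'

/-- Triangle inequality for transport costs. -/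
theorem transportCost_le_add [Nonempty M] {f g h : M → M → ℝ}
    (hf : Continuous (Function.uncurry f)) (hg : Continuous (Function.uncurry g))
    (hh : Continuous (Function.uncurry h)) (hle : ∀ x z y, h x y ≤ f x z + g z y)
    (μ ν ρ : Measure M) [IsProbabilityMeasure μ] [IsProbabilityMeasure ν]
    [IsProbabilityMeasure ρ] :
    transportCost h μ ρ ≤ transportCost f μ ν + transportCost g ν ρ := by
  rw [← sub_le_iff_le_add]
  refine le_transportCost fun P hP hPc => ?_
  rw [sub_le_iff_le_add, ← sub_le_iff_le_add']
  refine le_transportCost fun Q hQ hQc => ?_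
  rw [sub_le_iff_le_add']
  obtain ⟨R, hR, hRP, hRQ⟩ := exists_measure_gluing P Q (hPc.2.trans hQc.1.symm)
  have hm : Measurable fun p : (M × M) × M => (p.1.1, p.2) := by fun_prop
  have hm' : Measurable fun p : (M × M) × M => (p.1.2, p.2) := by fun_prop
  have : IsProbabilityMeasure (R.map fun p => (p.1.1, p.2)) :=
    Measure.isProbabilityMeasure_map hm.aemeasurable
  have hc : IsCoupling (R.map fun p => (p.1.1, p.2)) μ ρ := by
    constructor
    · rw [Measure.map_map measurable_fst hm, ← hPc.1, ← hRP,
        Measure.map_map measurable_fst measurable_fst]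
      rfl
    · rw [Measure.map_map measurable_snd hm, ← hQc.2, ← hRQ,
        Measure.map_map measurable_snd hm']
      rfl
  refine (transportCost_le_integral hh _ hc).trans ?_
  have hf' : Continuous fun p : (M × M) × M => f p.1.1 p.1.2 := hf.comp continuous_fst
  have hg' : Continuous fun p : (M × M) × M => g p.1.2 p.2 :=
    hg.comp (by fun_prop : Continuous fun p : (M × M) × M => (p.1.2, p.2))
  have hh' : Continuous fun p : (M × M) × M => h p.1.1 p.2 :=
    hh.comp (by fun_prop : Continuous fun p : (M × M) × M => (p.1.1, p.2))
  have i1 := integral_map (μ := R) hm.aemeasurable hh.aestronglyMeasurable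
  have i2 := integral_map (μ := R) measurable_fst.aemeasurable hf.aestronglyMeasurable
  have i3 := integral_map (μ := R) hm'.aemeasurable hg.aestronglyMeasurable
  simp only [Function.uncurry] at i1 i2 i3
  rw [← hRP, ← hRQ, i1, i2, i3,
    ← integral_add (hf'.integrable_of_compactSpace R) (hg'.integrable_of_compactSpace R)]
  exact integral_mono (hh'.integrable_of_compactSpace R)
    ((hf'.add hg').integrable_of_compactSpace R) fun p => hle _ _ _

/-- Measurable selection of approximate minimizers of a jointly continuous function. -/
theorem exists_measurable_lt_iInf_add {X Z : Type*} [TopologicalSpace X] [MeasurableSpace X]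
    [OpensMeasurableSpace X] [TopologicalSpace Z] [TopologicalSpace.SeparableSpace Z]
    [Nonempty Z] [MeasurableSpace Z] {F : X → Z → ℝ} (hF : Continuous (Function.uncurry F))
    {m : X → ℝ} (hm : Continuous m) (hFm : ∀ x, m x = ⨅ z, F x z) {ε : ℝ} (hε : 0 < ε) :
    ∃ φ : X → Z, Measurable φ ∧ ∀ x, F x (φ x) < m x + ε := by
  classical
  have hex : ∀ x, ∃ n, F x (TopologicalSpace.denseSeq Z n) < m x + ε := by
    intro x
    obtain ⟨z, hz⟩ := exists_lt_of_ciInf_lt (f := F x) (a := m x + ε) (by linarith [hFm x])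
    have ho : IsOpen {z | F x z < m x + ε} :=
      isOpen_lt (hF.comp (by fun_prop : Continuous fun z => (x, z))) continuous_const
    exact (TopologicalSpace.denseRange_denseSeq Z).exists_mem_open ho ⟨z, hz⟩
  refine ⟨fun x => TopologicalSpace.denseSeq Z (Nat.find (hex x)), ?_,
    fun x => Nat.find_spec (hex x)⟩
  refine (measurable_of_countable (TopologicalSpace.denseSeq Z)).comp
    (measurable_find hex fun k => IsOpen.measurableSet ?_)
  exact isOpen_lt (hF.comp (by fun_prop : Continuous fun x => (x, _)))
    (hm.add continuous_const)

/-- The transport problem through an intermediate marginal has a minimizer. -/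
theorem exists_integral_add_le_transportCost [Nonempty M] {f g h : M → M → ℝ}
    (hf : Continuous (Function.uncurry f)) (hg : Continuous (Function.uncurry g))
    (hh : Continuous (Function.uncurry h)) (hinf : ∀ x y, h x y = ⨅ z, (f x z + g z y))
    (μ ρ : Measure M) [IsProbabilityMeasure μ] [IsProbabilityMeasure ρ] :
    ∃ Q : Measure ((M × M) × M), IsProbabilityMeasure Q ∧
      Q.map (fun p => p.1.1) = μ ∧ Q.map Prod.snd = ρ ∧
      ∫ p : (M × M) × M, f p.1.1 p.1.2 + g p.1.2 p.2 ∂Q ≤ transportCost h μ ρ := by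
  have c1 : Continuous fun p : (M × M) × M => p.1.1 := by fun_prop
  have c2 : Continuous fun p : (M × M) × M => p.2 := by fun_prop
  have hF : Continuous fun p : (M × M) × M => f p.1.1 p.1.2 + g p.1.2 p.2 :=
    (hf.comp continuous_fst).add (hg.comp (by fun_prop : Continuous fun p : (M × M) × M => (p.1.2, p.2)))
  let K : Set (ProbabilityMeasure ((M × M) × M)) :=
    {R | R.map c1.measurable.aemeasurable = ⟨μ, inferInstance⟩ ∧
      R.map c2.measurable.aemeasurable = ⟨ρ, inferInstance⟩}
  have hK : IsCompact K :=
    ((isClosed_eq (ProbabilityMeasure.continuous_map c1) continuous_const).inter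
      (isClosed_eq (ProbabilityMeasure.continuous_map c2) continuous_const)).isCompact
  have mem_K (R : ProbabilityMeasure ((M × M) × M)) : R ∈ K ↔
      (R : Measure ((M × M) × M)).map (fun p => p.1.1) = μ ∧ (R : Measure ((M × M) × M)).map (fun p => p.2) = ρ :=
    and_congr Subtype.ext_iff Subtype.ext_iff
  have key : ∀ P : Measure (M × M), IsProbabilityMeasure P → IsCoupling P μ ρ → ∀ ε > 0,
      ∃ R ∈ K, ∫ p : (M × M) × M, f p.1.1 p.1.2 + g p.1.2 p.2 ∂(R : Measure ((M × M) × M))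
        ≤ ∫ p, h p.1 p.2 ∂P + ε := by
    intro P hP hPc ε hε
    have hF' : Continuous (Function.uncurry fun (q : M × M) z => f q.1 z + g z q.2) :=
      (hf.comp (by fun_prop : Continuous fun p : (M × M) × M => (p.1.1, p.2))).add
        (hg.comp (by fun_prop : Continuous fun p : (M × M) × M => (p.2, p.1.2)))
    obtain ⟨φ, hφ, hφε⟩ := exists_measurable_lt_iInf_add hF' hh (fun q => hinf q.1 q.2) hε
    have hψ : Measurable fun q : M × M => ((q.1, φ q), q.2) := by fun_prop
    have hR : IsProbabilityMeasure (P.map fun q : M × M => ((q.1, φ q), q.2)) :=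
      Measure.isProbabilityMeasure_map hψ.aemeasurable
    refine ⟨⟨P.map fun q : M × M => ((q.1, φ q), q.2), hR⟩, (mem_K _).2 ⟨?_, ?_⟩, ?_⟩
    · rw [ProbabilityMeasure.coe_mk, Measure.map_map c1.measurable hψ]
      exact hPc.1
    · rw [ProbabilityMeasure.coe_mk, Measure.map_map c2.measurable hψ]
      exact hPc.2
    · have hi : Integrable (fun q : M × M => h q.1 q.2) P := hh.integrable_of_compactSpace P
      have hFi := (integrable_map_measure hF.aestronglyMeasurable hψ.aemeasurable).1
        (hF.integrable_of_compactSpace (P.map fun q : M × M => ((q.1, φ q), q.2)))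
      rw [ProbabilityMeasure.coe_mk, integral_map hψ.aemeasurable hF.aestronglyMeasurable]
      calc _ ≤ ∫ q, (h q.1 q.2 + ε) ∂P :=
            integral_mono hFi (hi.add (integrable_const ε)) fun q => (hφε q).le
        _ = ∫ q, h q.1 q.2 ∂P + ε := by
            rw [integral_add hi (integrable_const ε)]
            simp
  obtain ⟨R₀, hR₀, -⟩ := key (μ.prod ρ) inferInstance
    ⟨by simp [Measure.map_fst_prod], by simp [Measure.map_snd_prod]⟩ 1 one_pos
  obtain ⟨R, hRK, hRmin⟩ := hK.exists_isMinOn ⟨R₀, hR₀⟩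
    (ProbabilityMeasure.continuous_integral_continuousMap
      (⟨_, hF⟩ : C((M × M) × M, ℝ))).continuousOn
  obtain ⟨h1, h2⟩ := (mem_K R).1 hRK
  refine ⟨R, inferInstance, h1, h2, le_transportCost fun P hP hPc => ?_⟩
  refine le_of_forall_pos_le_add fun ε hε => ?_
  obtain ⟨R', hR', hle⟩ := key P hP hPc ε hε
  exact (hRmin hR').trans hle

theorem exists_transportCost_eq_add [Nonempty M] {f g h : M → M → ℝ}
    (hf : Continuous (Function.uncurry f)) (hg : Continuous (Function.uncurry g))
    (hh : Continuous (Function.uncurry h)) (hinf : ∀ x y, h x y = ⨅ z, (f x z + g z y))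
    (μ ρ : Measure M) [IsProbabilityMeasure μ] [IsProbabilityMeasure ρ] :
    ∃ ν : Measure M, IsProbabilityMeasure ν ∧
      transportCost h μ ρ = transportCost f μ ν + transportCost g ν ρ := by
  obtain ⟨R, hR, h1, h2, hle⟩ := exists_integral_add_le_transportCost hf hg hh hinf μ ρ
  have m2 : Measurable fun p : (M × M) × M => p.1.2 := by fun_prop
  have c23 : Continuous fun p : (M × M) × M => (p.1.2, p.2) := by fun_prop
  have hν : IsProbabilityMeasure (R.map fun p => p.1.2) :=
    Measure.isProbabilityMeasure_map m2.aemeasurable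
  refine ⟨R.map fun p => p.1.2, hν, le_antisymm ?_ ?_⟩
  · refine transportCost_le_add hf hg hh (fun x z y => ?_) μ _ ρ
    have hz : Continuous fun z => f x z + g z y :=
      (hf.comp (by fun_prop : Continuous fun z => (x, z))).add
        (hg.comp (by fun_prop : Continuous fun z => (z, y)))
    rw [hinf]
    exact ciInf_le (isCompact_range hz).bddBelow z
  · refine le_trans ?_ hle
    have : IsProbabilityMeasure (R.map Prod.fst) :=
      Measure.isProbabilityMeasure_map measurable_fst.aemeasurable
    have : IsProbabilityMeasure (R.map fun p => (p.1.2, p.2)) :=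
      Measure.isProbabilityMeasure_map c23.measurable.aemeasurable
    refine (add_le_add ?_ ?_).trans_eq
      (integral_add ((hf.comp continuous_fst).integrable_of_compactSpace R)
        ((hg.comp c23).integrable_of_compactSpace R)).symm
    · refine (transportCost_le_integral hf (R.map Prod.fst) ⟨?_, ?_⟩).trans_eq ?_
      · rw [Measure.map_map measurable_fst measurable_fst, ← h1]
        rfl
      · rw [Measure.map_map measurable_snd measurable_fst]
        rfl
      · exact integral_map measurable_fst.aemeasurable hf.aestronglyMeasurable
    · refine (transportCost_le_integral hg (R.map fun p => (p.1.2, p.2)) ⟨?_, ?_⟩).trans_eq ?_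
      · rw [Measure.map_map measurable_fst c23.measurable]
        rfl
      · rw [Measure.map_map measurable_snd c23.measurable, ← h2]
        rfl
      · exact integral_map c23.measurable.aemeasurable hg.aestronglyMeasurable

end Transport

/-- **Interpolation of transport costs** (Lemma `interpolation`): on a compact metric
space `M` with continuous cost `c` satisfying the dynamic programming identity, for any
Borel probability measures `ν₁, ν₂` and `0 < s < T` there is a Borel probability measure
`ν` with `C_T(ν₁,ν₂) = C_s(ν₁,ν) + C_{T−s}(ν,ν₂)`. -/
theorem transport_cost_interpolation
    (M : Type*) [MetricSpace M] [CompactSpace M] [Nonempty M]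
    [MeasurableSpace M] [BorelSpace M]
    (c : ℝ → M → M → ℝ)
    (hc : ContinuousOn (fun p : ℝ × M × M => c p.1 p.2.1 p.2.2) {p | 0 < p.1})
    (hdpp : ∀ s t : ℝ, 0 < s → 0 < t → ∀ x y : M,
      c (s + t) x y = ⨅ z : M, (c s x z + c t z y))
    (ν₁ ν₂ : Measure M) (hν₁ : IsProbabilityMeasure ν₁) (hν₂ : IsProbabilityMeasure ν₂)
    (s T : ℝ) (hs : 0 < s) (hsT : s < T) :
    ∃ ν : Measure M, IsProbabilityMeasure ν ∧
      transportCost (c T) ν₁ ν₂ =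
        transportCost (c s) ν₁ ν + transportCost (c (T - s)) ν ν₂ := by
  have hcont : ∀ t, 0 < t → Continuous (Function.uncurry (c t)) := fun t ht =>
    hc.comp_continuous (by fun_prop : Continuous fun p : M × M => (t, p)) fun _ => ht
  refine exists_transportCost_eq_add (hcont s hs) (hcont _ (sub_pos.2 hsT))
    (hcont T (hs.trans hsT)) (fun x y => ?_) ν₁ ν₂
  rw [← hdpp s (T - s) hs (sub_pos.2 hsT), add_sub_cancel]
end
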